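/- For every 0 < r < 1, every n ≥ 1, and φ_a ∈ {0, π}, the quantities A_n satisfy the recursion A_{n+2}(φ_a) = ((1 − 9r²)/(1 − r²))³ · A_n(φ_a) + A_2(φ_a) · (R_r^n)'(φ_a). -/

import Mathlib

open Real Filter

/-- The reflection map of the unit circle with light source at `(r,0)`. -/
noncomputable def R (r : ℝ) (φ : ℝ) : ℝ :=
  φ + π - 2 * arctan (r * sin φ / (1 - r * cos φ))

/-- The angle `φ_c ∈ (0,π)` with `cos φ_c = (1 − √(1+8r²))/(4r)`. -/
noncomputable def φc (r : ℝ) : ℝ :=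
  arccos ((1 - Real.sqrt (1 + 8 * r ^ 2)) / (4 * r))

/-- `x`-coordinate of the caustic of `R_r^n`. -/
noncomputable def xc (r : ℝ) (n : ℕ) (φ : ℝ) : ℝ :=
  (deriv ((R r)^[n]) φ * cos φ + cos ((R r)^[n] φ)) / (1 + deriv ((R r)^[n]) φ)

/-- `y`-coordinate of the caustic of `R_r^n`. -/
noncomputable def yc (r : ℝ) (n : ℕ) (φ : ℝ) : ℝ :=
  (deriv ((R r)^[n]) φ * sin φ + sin ((R r)^[n] φ)) / (1 + deriv ((R r)^[n]) φ)

/-- The quantity `A_n(φ) = −(R_r^n)'(φ) + ((R_r^n)'(φ))³ + 2 (R_r^n)'''(φ)`. -/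
noncomputable def A (r : ℝ) (n : ℕ) (φ : ℝ) : ℝ :=
  -(deriv ((R r)^[n]) φ) + (deriv ((R r)^[n]) φ) ^ 3 + 2 * iteratedDeriv 3 ((R r)^[n]) φ

lemma one_sub_mul_cos_pos {r : ℝ} (hr : 0 < r) (hr1 : r < 1) (φ : ℝ) : 0 < 1 - r * cos φ := by
  nlinarith [cos_le_one φ]

lemma contDiff_R {r : ℝ} (hr : 0 < r) (hr1 : r < 1) (m : WithTop ℕ∞) : ContDiff ℝ m (R r) := by
  unfold R
  refine (contDiff_id.add contDiff_const).sub (contDiff_const.mul (contDiff_arctan.comp ?_))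
  exact (contDiff_const.mul contDiff_sin).div (contDiff_const.sub (contDiff_const.mul contDiff_cos))
    fun φ => (one_sub_mul_cos_pos hr hr1 φ).ne'

lemma contDiff_iterate {f : ℝ → ℝ} {m : WithTop ℕ∞} (hf : ContDiff ℝ m f) (n : ℕ) :
    ContDiff ℝ m f^[n] := by
  induction n with
  | zero => exact contDiff_id
  | succ n ih => exact ih.comp hf

lemma R_add_two_pi (r φ : ℝ) : R r (φ + 2 * π) = R r φ + 2 * π := by
  simp only [R, sin_add_two_pi, cos_add_two_pi]
  ring

lemma R_iterate_add_two_pi (r φ : ℝ) (n : ℕ) :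
    (R r)^[n] (φ + 2 * π) = (R r)^[n] φ + 2 * π :=
  Function.Commute.iterate_left (f := R r) (g := (· + 2 * π)) (R_add_two_pi r) n φ

lemma R_neg (r φ : ℝ) : R r (-φ) = 2 * π - R r φ := by
  simp only [R, sin_neg, cos_neg, mul_neg, neg_div, arctan_neg]
  ring

lemma R_two_pi_sub (r φ : ℝ) : R r (2 * π - φ) = 4 * π - R r φ := by
  have h := R_add_two_pi r (-φ)
  rw [R_neg] at h
  rw [show 2 * π - φ = -φ + 2 * π by ring, h]
  ring

lemma R_four_pi_sub (r φ : ℝ) : R r (4 * π - φ) = 6 * π - R r φ := by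
  have h := R_add_two_pi r (2 * π - φ)
  rw [R_two_pi_sub] at h
  rw [show 4 * π - φ = 2 * π - φ + 2 * π by ring, h]
  ring

lemma R_zero (r : ℝ) : R r 0 = π := by simp [R]

lemma R_pi (r : ℝ) : R r π = 2 * π := by simp [R]; ring

lemma hasDerivAt_R {r : ℝ} (hr : 0 < r) (hr1 : r < 1) (φ : ℝ) :
    HasDerivAt (R r)
      (1 - 2 * (1 / (1 + (r * sin φ / (1 - r * cos φ)) ^ 2) *
        ((r * cos φ * (1 - r * cos φ) - r * sin φ * (r * sin φ)) / (1 - r * cos φ) ^ 2))) φ := by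
  have hs := (hasDerivAt_sin φ).const_mul r
  have hc : HasDerivAt (fun x => 1 - r * cos x) (r * sin φ) φ := by
    simpa using ((hasDerivAt_cos φ).const_mul r).const_sub 1
  have hq := (hs.div hc (one_sub_mul_cos_pos hr hr1 φ).ne').arctan
  exact ((hasDerivAt_id φ).add_const π).sub (hq.const_mul 2)

lemma deriv_R_zero {r : ℝ} (hr : 0 < r) (hr1 : r < 1) :
    deriv (R r) 0 = (1 - 3 * r) / (1 - r) := by
  rw [(hasDerivAt_R hr hr1 0).deriv]
  have : 1 - r ≠ 0 := by linarith
  simp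
  field_simp
  ring

lemma deriv_R_pi {r : ℝ} (hr : 0 < r) (hr1 : r < 1) :
    deriv (R r) π = (1 + 3 * r) / (1 + r) := by
  rw [(hasDerivAt_R hr hr1 π).deriv]
  have : 1 + r ≠ 0 := by linarith
  simp
  field_simp
  ring

lemma deriv_R_two_pi {r : ℝ} : deriv (R r) (2 * π) = deriv (R r) 0 := by
  have h : (fun x => R r (x + 2 * π)) = fun x => R r x + 2 * π := funext (R_add_two_pi r)
  have h0 := congrArg (fun f => deriv f 0) h
  simpa [deriv_comp_add_const] using h0

/-- A function that is odd about a point has vanishing second derivative there. -/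
lemma iteratedDeriv_two_eq_zero_of_point_symmetric {h : ℝ → ℝ} {a c : ℝ}
    (hsymm : ∀ x, h (2 * a - x) = c - h x) : iteratedDeriv 2 h a = 0 := by
  have h1 : (fun x => h (2 * a - x)) = fun x => c - h x := funext hsymm
  have h2 := congrArg (fun f => iteratedDeriv 2 f a) h1
  simp only [iteratedDeriv_const_sub two_pos, iteratedDeriv_neg] at h2
  have h3 : iteratedDeriv 2 (fun x => h (2 * a - x)) a = iteratedDeriv 2 h a := by
    rw [iteratedDeriv_comp_const_sub]
    simp [two_mul]
  linarith

lemma iteratedDeriv_R_iterate_add_two_pi (r φ : ℝ) (n : ℕ) {k : ℕ} (hk : 0 < k) :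
    iteratedDeriv k (R r)^[n] (φ + 2 * π) = iteratedDeriv k (R r)^[n] φ := by
  have h : (fun x => (R r)^[n] (x + 2 * π)) = fun x => 2 * π + (R r)^[n] x :=
    funext fun x => by rw [R_iterate_add_two_pi, add_comm]
  have h0 := congrArg (fun f => iteratedDeriv k f φ) h
  simpa only [iteratedDeriv_comp_add_const, iteratedDeriv_const_add hk] using h0

lemma R_iterate_two_apply (r : ℝ) {a : ℝ} (ha : a = 0 ∨ a = π) :
    (R r)^[2] a = a + 2 * π := by
  rcases ha with rfl | rfl
  · simp [R_zero, R_pi]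
  · have h := R_add_two_pi r 0
    simp only [zero_add, R_zero] at h
    simp [R_pi, h]

lemma deriv_R_iterate_two {r : ℝ} (hr : 0 < r) (hr1 : r < 1) {a : ℝ} (ha : a = 0 ∨ a = π) :
    deriv (R r)^[2] a = (1 - 9 * r ^ 2) / (1 - r ^ 2) := by
  have hd (x : ℝ) : DifferentiableAt ℝ (R r) x := (hasDerivAt_R hr hr1 x).differentiableAt
  have h1 : 1 - r ≠ 0 := by linarith
  have h2 : 1 + r ≠ 0 := by linarith
  have h3 : 1 - r ^ 2 ≠ 0 := by nlinarith
  rw [show (R r)^[2] = R r ∘ R r from rfl, deriv_comp a (hd _) (hd _)]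
  rcases ha with rfl | rfl
  · rw [R_zero, deriv_R_zero hr hr1, deriv_R_pi hr hr1, div_mul_div_comm]
    congr 1 <;> ring
  · rw [R_pi, deriv_R_two_pi, deriv_R_zero hr hr1, deriv_R_pi hr hr1, div_mul_div_comm]
    congr 1 <;> ring

lemma iteratedDeriv_two_R_iterate_two (r : ℝ) {a : ℝ} (ha : a = 0 ∨ a = π) :
    iteratedDeriv 2 (R r)^[2] a = 0 := by
  rcases ha with rfl | rfl
  · refine iteratedDeriv_two_eq_zero_of_point_symmetric (c := 4 * π) fun x => ?_
    simp [R_neg, R_two_pi_sub]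
  · refine iteratedDeriv_two_eq_zero_of_point_symmetric (c := 6 * π) fun x => ?_
    simp [R_two_pi_sub, R_four_pi_sub]

theorem stmt_10 (r : ℝ) (hr : 0 < r) (hr1 : r < 1) (n : ℕ) (hn : 1 ≤ n)
    (φa : ℝ) (hφa : φa = 0 ∨ φa = π) :
    A r (n + 2) φa =
      ((1 - 9 * r ^ 2) / (1 - r ^ 2)) ^ 3 * A r n φa +
        A r 2 φa * deriv ((R r)^[n]) φa := by
  have hsmooth (m : ℕ) : ContDiff ℝ 3 (R r)^[m] := contDiff_iterate (contDiff_R hr hr1 3) m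
  have hdiff (m : ℕ) : Differentiable ℝ (R r)^[m] := (hsmooth m).differentiable (by norm_num)
  have hper : deriv (R r)^[n] (φa + 2 * π) = deriv (R r)^[n] φa := by
    simpa only [iteratedDeriv_one] using
      iteratedDeriv_R_iterate_add_two_pi r φa n one_pos
  have h1 : deriv (R r)^[n + 2] φa = deriv (R r)^[n] φa * deriv (R r)^[2] φa := by
    rw [Function.iterate_add, deriv_comp φa (hdiff n _) (hdiff 2 _), R_iterate_two_apply r hφa,
      hper]
  have h3 : iteratedDeriv 3 (R r)^[n + 2] φa =
      iteratedDeriv 3 (R r)^[n] φa * deriv (R r)^[2] φa ^ 3 +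
        deriv (R r)^[n] φa * iteratedDeriv 3 (R r)^[2] φa := by
    rw [Function.iterate_add,
      iteratedDeriv_comp_three (hsmooth n).contDiffAt (hsmooth 2).contDiffAt,
      R_iterate_two_apply r hφa, iteratedDeriv_two_R_iterate_two r hφa, hper,
      iteratedDeriv_R_iterate_add_two_pi r φa n three_pos]
    ring
  simp only [A, h1, h3, ← deriv_R_iterate_two hr hr1 hφa]
  ring
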